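/- arXiv:math-ph/0310056 — 7 statements merged into one kernel-verified Lean document; each statement's English description precedes it below -/
import Mathlib

section
/- Let e_a, e_b, e_c ∈ ℂ and s, t, c ∈ ℂ with s² = e_b − e_a, t² = e_c − e_a, s·t = c and c ≠ 0. Fix φ ∈ ℂ, set x = e_a + c·exp(2iφ) and y² = (x − e_a)(x − e_b)(x − e_c), and set E(φ) = (s − t)² + 4c·sin²(φ). If E(φ) ≠ 0, then y² ≠ 0 and (2ic·exp(2iφ))² / (4y²) = 1 / E(φ); moreover E(φ) = (e_b − e_a) + (e_c − e_a) − 2c·cos(2φ). (Equivalently, the elliptic differential du = dx/(2y) satisfies (du/dφ)² = 1/E(φ) along x(φ) = e_a + c·exp(2iφ).) -/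
/-- `2 cos (2φ)` cleared of the denominator `exp (2iφ)`. -/
theorem two_mul_exp_mul_cos_two_mul (φ : ℂ) :
    2 * Complex.exp (2 * Complex.I * φ) * Complex.cos (2 * φ) =
      Complex.exp (2 * Complex.I * φ) ^ 2 + 1 := by
  have h : 2 * φ * Complex.I = 2 * Complex.I * φ := by ring
  have hne := Complex.exp_ne_zero (2 * Complex.I * φ)
  rw [Complex.cos, neg_mul, h, Complex.exp_neg]
  field_simp

/-- Lemma 2.1 (branch-free squared form): along `x = e_a + c·exp(2iφ)` with
`c = st`, `s² = e_b − e_a`, `t² = e_c − e_a`, the elliptic differential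
`du = dx/(2y)` satisfies `(du/dφ)² = 1/E(φ)` where
`E(φ) = (s − t)² + 4c·sin²φ = (e_b − e_a) + (e_c − e_a) − 2c·cos 2φ`. -/
theorem elliptic_differential_squared
    (ea eb ec s t c : ℂ) (hs : s ^ 2 = eb - ea) (ht : t ^ 2 = ec - ea)
    (hst : s * t = c) (hc : c ≠ 0) (φ : ℂ) :
    let x : ℂ := ea + c * Complex.exp (2 * Complex.I * φ)
    let y2 : ℂ := (x - ea) * (x - eb) * (x - ec)
    let E : ℂ := (s - t) ^ 2 + 4 * c * Complex.sin φ ^ 2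
    E ≠ 0 →
      y2 ≠ 0 ∧
      (2 * Complex.I * c * Complex.exp (2 * Complex.I * φ)) ^ 2 / (4 * y2) = 1 / E ∧
      E = (eb - ea) + (ec - ea) - 2 * c * Complex.cos (2 * φ) := by
  intro x y2 E hE
  have hcos : E = (eb - ea) + (ec - ea) - 2 * c * Complex.cos (2 * φ) := by
    simp only [E]
    rw [Complex.cos_two_mul, Complex.cos_sq', ← hs, ← ht, ← hst]
    ring
  have hexp := two_mul_exp_mul_cos_two_mul φ
  have hz := Complex.exp_ne_zero (2 * Complex.I * φ)
  have hy : y2 = -(c * Complex.exp (2 * Complex.I * φ)) ^ 2 * E := by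
    have hc2 : (eb - ea) * (ec - ea) = c ^ 2 := by rw [← hs, ← ht, ← hst]; ring
    rw [hcos]
    simp only [y2, x]
    linear_combination c * Complex.exp (2 * Complex.I * φ) * hc2 -
      c ^ 3 * Complex.exp (2 * Complex.I * φ) * hexp
  have hy0 : y2 ≠ 0 := by
    rw [hy]
    exact mul_ne_zero (neg_ne_zero.mpr (pow_ne_zero 2 (mul_ne_zero hc hz))) hE
  refine ⟨hy0, ?_, hcos⟩
  rw [div_eq_div_iff (mul_ne_zero (by norm_num) hy0) hE, hy]
  linear_combination 4 * c ^ 2 * Complex.exp (2 * Complex.I * φ) ^ 2 * E * Complex.I_sq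
end

section
/- Let e₁, e₂, e₃ ∈ ℂ and fix a ∈ {1,2,3} with {a,b,c} = {1,2,3}. Let x, y : ℝ → ℂ be differentiable functions such that for all u: y(u)² = (x(u) − e₁)(x(u) − e₂)(x(u) − e₃), x'(u) = 2y(u), y'(u) = f'(x(u)) where f(X) = (X − e₁)(X − e₂)(X − e₃), and x(u) ≠ e_a. Then the function k(u) := −2i·y(u)/(x(u) − e_a) is twice differentiable and satisfies k'' + (1/2)·k³ + 2(2e_a − e_b − e_c)·k = 0. -/
/-- Proposition 2.1 (Euler's elastica), curvature form: along the elliptic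
curve `y² = (x−e₁)(x−e₂)(x−e₃)` with `dx/du = 2y`, `dy/du = f'(x)`, and a
labelling `{e_a, e_b, e_c} = {e₁, e₂, e₃}` with `x(u) ≠ e_a`, the curvature
`k(u) = −2i·y(u)/(x(u) − e_a)` is twice differentiable and satisfies the
stationary modified KdV equation `k'' + (1/2)k³ + 2(2e_a − e_b − e_c)k = 0`. -/
theorem elastica_curvature_equation
    (e1 e2 e3 ea eb ec : ℂ)
    (hperm : ({ea, eb, ec} : Multiset ℂ) = ({e1, e2, e3} : Multiset ℂ))
    (x y : ℝ → ℂ) (hx : Differentiable ℝ x) (hy : Differentiable ℝ y)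
    (hcurve : ∀ u, y u ^ 2 = (x u - e1) * (x u - e2) * (x u - e3))
    (hx' : ∀ u, deriv x u = 2 * y u)
    (hy' : ∀ u, deriv y u =
      (x u - e2) * (x u - e3) + (x u - e1) * (x u - e3) + (x u - e1) * (x u - e2))
    (hne : ∀ u, x u ≠ ea) :
    let k : ℝ → ℂ := fun u => -2 * Complex.I * y u / (x u - ea)
    Differentiable ℝ k ∧ Differentiable ℝ (deriv k) ∧
    ∀ u, deriv (deriv k) u + (1 / 2) * k u ^ 3 + 2 * (2 * ea - eb - ec) * k u = 0 := by
  have hsum : ea + eb + ec = e1 + e2 + e3 := by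
    simpa [add_assoc] using congrArg Multiset.sum hperm
  have hsq : ea ^ 2 + eb ^ 2 + ec ^ 2 = e1 ^ 2 + e2 ^ 2 + e3 ^ 2 := by
    have h := congrArg (fun s => (s.map (· ^ 2)).sum) hperm
    simpa only [Multiset.insert_eq_cons, Multiset.map_cons, Multiset.map_singleton,
      Multiset.sum_cons, Multiset.sum_singleton, add_assoc] using h
  have hprod : ea * eb * ec = e1 * e2 * e3 := by
    simpa [mul_assoc] using congrArg Multiset.prod hperm
  have hpair : ea * eb + ea * ec + eb * ec = e1 * e2 + e1 * e3 + e2 * e3 := by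
    linear_combination (1 / 2) * (ea + eb + ec + e1 + e2 + e3) * hsum - (1 / 2) * hsq
  have hcurve_abc : ∀ u, y u ^ 2 = (x u - ea) * (x u - eb) * (x u - ec) := fun u => by
    linear_combination hcurve u + x u ^ 2 * hsum - x u * hpair + hprod
  have hX : ∀ u, x u - ea ≠ 0 := fun u => sub_ne_zero.mpr (hne u)
  have hdx : ∀ u, HasDerivAt (fun v => x v - ea) (2 * y u) u := fun u => by
    simpa only [hx'] using (hx u).hasDerivAt.sub_const ea
  have hdy : ∀ u, HasDerivAt y
      ((x u - eb) * (x u - ec) + (x u - ea) * (x u - ec) + (x u - ea) * (x u - eb)) u := fun u => by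
    refine (hy u).hasDerivAt.congr_deriv ?_
    rw [hy']
    linear_combination 2 * x u * hsum - hpair
  intro k
  have hk : ∀ u, HasDerivAt k
      (-2 * Complex.I * ((x u - ea) - (ea - eb) * (ea - ec) / (x u - ea))) u := fun u => by
    refine (((hdy u).const_mul (-2 * Complex.I)).div (hdx u) (hX u)).congr_deriv ?_
    have := hX u
    field_simp
    linear_combination 2 * hcurve_abc u
  have hdk : deriv k =
      fun u => -2 * Complex.I * ((x u - ea) - (ea - eb) * (ea - ec) / (x u - ea)) :=
    funext fun u => (hk u).deriv
  have hk2 : ∀ u, HasDerivAt (deriv k)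
      (-2 * Complex.I * (2 * y u * (1 + (ea - eb) * (ea - ec) / (x u - ea) ^ 2))) u := fun u => by
    rw [hdk]
    refine (((hdx u).sub ((hasDerivAt_const u ((ea - eb) * (ea - ec))).div
      (hdx u) (hX u))).const_mul (-2 * Complex.I)).congr_deriv ?_
    have := hX u
    field_simp
    ring
  refine ⟨fun u => (hk u).differentiableAt, fun u => (hk2 u).differentiableAt, fun u => ?_⟩
  rw [(hk2 u).deriv]
  have := hX u
  simp only [k]
  have hI : Complex.I ^ 3 = -Complex.I := Complex.I_pow_three
  simp only [div_pow, mul_pow, hI]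
  field_simp
  linear_combination 4 * Complex.I * y u * hcurve_abc u
end

section
/- Let e₁, e₂, e₃ ∈ ℂ and fix a ∈ {1,2,3} with {a,b,c} = {1,2,3}. Let x, y : ℝ → ℂ be differentiable with y(u)² = (x(u) − e₁)(x(u) − e₂)(x(u) − e₃), x'(u) = 2y(u), and y'(u) = f'(x(u)) where f(X) = (X − e₁)(X − e₂)(X − e₃), and let φ : ℝ → ℂ be a three-times differentiable function with exp(iφ(u)) = x(u) − e_a for all u. Then φ satisfies the stationary modified KdV equation φ''' + (1/2)(φ')³ + 2(2e_a − e_b − e_c)·φ' = 0. -/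
/-- Equal three-element multisets have the same elementary symmetric functions. -/
theorem Multiset.triple_symmetric_functions_eq {R : Type*} [CommRing R] {a b c a' b' c' : R}
    (h : ({a, b, c} : Multiset R) = {a', b', c'}) :
    a + b + c = a' + b' + c' ∧ a * b + a * c + b * c = a' * b' + a' * c' + b' * c' ∧
      a * b * c = a' * b' * c' := by
  have hsum := congrArg Multiset.sum h
  have hprod := congrArg Multiset.prod h
  have hshift := congrArg (fun s : Multiset R => (s.map (1 + ·)).prod) h
  simp only [Multiset.insert_eq_cons, Multiset.sum_cons, Multiset.sum_singleton,
    Multiset.prod_cons, Multiset.prod_singleton, Multiset.map_cons,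
    Multiset.map_singleton] at hsum hprod hshift
  refine ⟨?_, ?_, ?_⟩
  · linear_combination hsum
  · linear_combination hshift - hsum - hprod
  · linear_combination hprod

/-- If `exp (iφ) = X`, then `φ' = -i X' / X`. -/
theorem deriv_eq_of_exp_I_mul_eq {φ X : ℝ → ℂ} {u : ℝ} (hφ : DifferentiableAt ℝ φ u)
    (h : ∀ v, Complex.exp (Complex.I * φ v) = X v) :
    deriv φ u = -Complex.I * (deriv X u / X u) := by
  have hne : X u ≠ 0 := h u ▸ Complex.exp_ne_zero _
  have hd : HasDerivAt X (Complex.exp (Complex.I * φ u) * (Complex.I * deriv φ u)) u := by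
    rw [← funext h]
    exact (hφ.hasDerivAt.const_mul Complex.I).cexp
  rw [hd.deriv, h u, mul_div_cancel_left₀ _ hne]
  linear_combination deriv φ u * Complex.I_sq

/-- Proposition 2.1: the tangent angle `φ` of the classical elastica, defined by
`exp(iφ(u)) = x(u) − e_a` along the elliptic curve `y² = (x−e₁)(x−e₂)(x−e₃)`
with `dx/du = 2y`, `dy/du = f'(x)`, satisfies the stationary modified KdV
equation `φ''' + (1/2)(φ')³ + 2(2e_a − e_b − e_c)·φ' = 0`. -/
theorem elastica_angle_equation
    (e1 e2 e3 ea eb ec : ℂ)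
    (hperm : ({ea, eb, ec} : Multiset ℂ) = ({e1, e2, e3} : Multiset ℂ))
    (x y : ℝ → ℂ) (hx : Differentiable ℝ x) (hy : Differentiable ℝ y)
    (hcurve : ∀ u, y u ^ 2 = (x u - e1) * (x u - e2) * (x u - e3))
    (hx' : ∀ u, deriv x u = 2 * y u)
    (hy' : ∀ u, deriv y u =
      (x u - e2) * (x u - e3) + (x u - e1) * (x u - e3) + (x u - e1) * (x u - e2))
    (φ : ℝ → ℂ)
    (hφ1 : Differentiable ℝ φ) (hφ2 : Differentiable ℝ (deriv φ))
    (hφ3 : Differentiable ℝ (deriv (deriv φ)))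
    (hangle : ∀ u, Complex.exp (Complex.I * φ u) = x u - ea) :
    ∀ u, deriv (deriv (deriv φ)) u + (1 / 2) * (deriv φ u) ^ 3
        + 2 * (2 * ea - eb - ec) * deriv φ u = 0 := by
  obtain ⟨hs1, hs2, hs3⟩ := Multiset.triple_symmetric_functions_eq hperm
  set p : ℂ := (ea - eb) * (ea - ec) with hp
  have hne : ∀ u, x u - ea ≠ 0 := fun u => hangle u ▸ Complex.exp_ne_zero _
  have hcurve_a : ∀ u, y u ^ 2 = (x u - ea) * (x u - eb) * (x u - ec) := fun u => by
    linear_combination hcurve u + x u ^ 2 * hs1 - x u * hs2 + hs3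
  have hy_a : ∀ u, HasDerivAt y
      ((x u - eb) * (x u - ec) + (x u - ea) * (x u - ec) + (x u - ea) * (x u - eb)) u := fun u =>
    (hy u).hasDerivAt.congr_deriv (by linear_combination hy' u + 2 * x u * hs1 - hs2)
  have hx_a : ∀ u, HasDerivAt (fun v => x v - ea) (2 * y u) u := fun u =>
    hx' u ▸ (hx u).hasDerivAt.sub_const ea
  have h1 : deriv φ = fun u => -Complex.I * (2 * y u / (x u - ea)) := funext fun u => by
    rw [deriv_eq_of_exp_I_mul_eq (hφ1 u) hangle, (hx_a u).deriv]
  have h2 : deriv (deriv φ) = fun u => -2 * Complex.I * ((x u - ea) - p / (x u - ea)) :=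
    funext fun u => by
      rw [h1]
      refine ((((hy_a u).const_mul 2).div (hx_a u) (hne u)).const_mul (-Complex.I)).deriv.trans ?_
      have := hne u
      field_simp
      linear_combination 2 * hcurve_a u
  intro u
  have h3 : deriv (deriv (deriv φ)) u =
      -2 * Complex.I * (2 * y u + p * (2 * y u) / (x u - ea) ^ 2) := by
    rw [h2]
    refine (((hx_a u).sub ((hasDerivAt_const u p).div (hx_a u) (hne u))).const_mul
      (-2 * Complex.I)).deriv.trans ?_
    ring
  have hu := hne u
  rw [h3, h1]
  have hI : (-Complex.I * (2 * y u / (x u - ea))) ^ 3 =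
      8 * Complex.I * y u * ((x u - eb) * (x u - ec)) / (x u - ea) ^ 2 := by
    have h : (-Complex.I * (2 * y u / (x u - ea))) ^ 3 =
        -(Complex.I ^ 2) * Complex.I * 8 * y u * y u ^ 2 / (x u - ea) ^ 3 := by
      rw [mul_pow, div_pow]
      ring
    rw [h, Complex.I_sq, hcurve_a u]
    field_simp
  rw [hI, hp]
  field_simp
  ring
end

section
/- Let e_a, e_b, e_c, e_d, e_e ∈ ℂ and c ∈ ℂ with c² = (e_b − e_a)(e_c − e_a) and c ≠ 0. Fix φ ∈ ℂ and set x = e_a + c·exp(2iφ), y² = (x − e_a)(x − e_b)(x − e_c)(x − e_d)(x − e_e), and E₁(φ) = (e_b − e_a) + (e_c − e_a) − 2c·cos(2φ). If E₁(φ) ≠ 0, (x − e_d) ≠ 0 and (x − e_e) ≠ 0, then y² ≠ 0 and (x·2ic·exp(2iφ))² / (4y²) = x² / (E₁(φ)·(x − e_d)(x − e_e)). -/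
/-- Lemma 3.1 (branch-free squared form): for the genus-two curve
`y² = (x−e_a)(x−e_b)(x−e_c)(x−e_d)(x−e_e)`, the differential
`du₂ = x·dx/(2y)` along the parametrization `x = e_a + c·exp(2iφ)`,
`c² = (e_b−e_a)(e_c−e_a)`, satisfies
`(du₂/dφ)² = x²/(E₁(φ)·(x−e_d)(x−e_e))`. -/
theorem genus_two_differential_squared
    (ea eb ec ed ee c : ℂ) (hc2 : c ^ 2 = (eb - ea) * (ec - ea)) (hc : c ≠ 0)
    (φ : ℂ) :
    let x : ℂ := ea + c * Complex.exp (2 * Complex.I * φ)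
    let y2 : ℂ := (x - ea) * (x - eb) * (x - ec) * (x - ed) * (x - ee)
    let E1 : ℂ := (eb - ea) + (ec - ea) - 2 * c * Complex.cos (2 * φ)
    E1 ≠ 0 → x - ed ≠ 0 → x - ee ≠ 0 →
      y2 ≠ 0 ∧
      (x * (2 * Complex.I * c * Complex.exp (2 * Complex.I * φ))) ^ 2 / (4 * y2)
        = x ^ 2 / (E1 * ((x - ed) * (x - ee))) := by
  intro x y2 E1 hE hd he
  have ht : Complex.exp (2 * Complex.I * φ) ≠ 0 := Complex.exp_ne_zero _
  have hcos : 2 * Complex.cos (2 * φ) * Complex.exp (2 * Complex.I * φ)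
      = Complex.exp (2 * Complex.I * φ) ^ 2 + 1 := by
    rw [Complex.two_cos, add_mul, ← Complex.exp_add, ← Complex.exp_add, sq, ← Complex.exp_add,
      ← Complex.exp_zero]
    ring_nf
  have hy : y2 = -(c * Complex.exp (2 * Complex.I * φ)) ^ 2 * (E1 * ((x - ed) * (x - ee))) := by
    simp only [y2, E1, x]
    generalize Complex.exp (2 * Complex.I * φ) = t at *
    linear_combination (c * t * (ea + c * t - ed) * (ea + c * t - ee)) *
      (-hc2 - c ^ 2 * hcos)
  have hy0 : y2 ≠ 0 := by
    rw [hy]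
    exact mul_ne_zero (neg_ne_zero.2 (pow_ne_zero 2 (mul_ne_zero hc ht)))
      (mul_ne_zero hE (mul_ne_zero hd he))
  refine ⟨hy0, ?_⟩
  rw [div_eq_div_iff (mul_ne_zero (by norm_num) hy0) (mul_ne_zero hE (mul_ne_zero hd he)), hy]
  linear_combination (4 * x ^ 2 * (c * Complex.exp (2 * Complex.I * φ)) ^ 2 *
    (E1 * ((x - ed) * (x - ee)))) * Complex.I_sq
end

section
/- Let e_a, e_b, e_c, e_d, e_e ∈ ℂ and c ∈ ℂ with c ≠ 0, e_a = −c, c² = (e_b − e_a)(e_c − e_a) and c² = (e_d − e_a)(e_e − e_a). Fix φ ∈ ℂ and set x = e_a + c·exp(2iφ), y² = (x − e_a)(x − e_b)(x − e_c)(x − e_d)(x − e_e), E₁(φ) = (e_b − e_a) + (e_c − e_a) − 2c·cos(2φ) and E₂(φ) = (e_d − e_a) + (e_e − e_a) − 2c·cos(2φ). If E₁(φ) ≠ 0 and E₂(φ) ≠ 0, then y² ≠ 0 and (x·2ic·exp(2iφ))² / (4y²) = 4c·sin²(φ) / (E₁(φ)·E₂(φ)). -/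
/-- With `w = exp(2iφ)`: `2w·cos(2φ) = w² + 1`. -/
theorem exp_mul_two_cos_two_mul (φ : ℂ) :
    Complex.exp (2 * Complex.I * φ) * (2 * Complex.cos (2 * φ))
      = Complex.exp (2 * Complex.I * φ) ^ 2 + 1 := by
  have h : Complex.exp (2 * Complex.I * φ) * Complex.exp (-(2 * Complex.I * φ)) = 1 := by
    rw [← Complex.exp_add, add_neg_cancel, Complex.exp_zero]
  rw [Complex.two_cos, show 2 * φ * Complex.I = 2 * Complex.I * φ by ring,
    show -(2 * φ) * Complex.I = -(2 * Complex.I * φ) by ring]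
  linear_combination h

/-- Lemma 3.3 (branch-free squared form): under the reality-condition
constraints `e_a = −c`, `c² = (e_b−e_a)(e_c−e_a) = (e_d−e_a)(e_e−e_a)`, the
genus-two differential `du₂ = x·dx/(2y)` along `x = e_a + c·exp(2iφ)` satisfies
`(du₂/dφ)² = 4c·sin²φ/(E₁(φ)·E₂(φ))`. -/
theorem genus_two_differential_reality_form
    (ea eb ec ed ee c : ℂ) (hc : c ≠ 0) (hea : ea = -c)
    (hc1 : c ^ 2 = (eb - ea) * (ec - ea)) (hc2 : c ^ 2 = (ed - ea) * (ee - ea))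
    (φ : ℂ) :
    let x : ℂ := ea + c * Complex.exp (2 * Complex.I * φ)
    let y2 : ℂ := (x - ea) * (x - eb) * (x - ec) * (x - ed) * (x - ee)
    let E1 : ℂ := (eb - ea) + (ec - ea) - 2 * c * Complex.cos (2 * φ)
    let E2 : ℂ := (ed - ea) + (ee - ea) - 2 * c * Complex.cos (2 * φ)
    E1 ≠ 0 → E2 ≠ 0 →
      y2 ≠ 0 ∧
      (x * (2 * Complex.I * c * Complex.exp (2 * Complex.I * φ))) ^ 2 / (4 * y2)
        = 4 * c * Complex.sin φ ^ 2 / (E1 * E2) := by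
  intro x y2 E1 E2 hE1 hE2
  have hcos := exp_mul_two_cos_two_mul φ
  have hsin : 2 * Complex.sin φ ^ 2 = 1 - Complex.cos (2 * φ) := by
    rw [Complex.cos_two_mul, Complex.cos_sq']
    ring
  have hw : Complex.exp (2 * Complex.I * φ) ≠ 0 := Complex.exp_ne_zero _
  simp only [x, y2]
  generalize Complex.exp (2 * Complex.I * φ) = w at *
  have h1 : (ea + c * w - eb) * (ea + c * w - ec) = -(c * w * E1) := by
    simp only [E1]
    linear_combination -hc1 - c ^ 2 * hcos
  have h2 : (ea + c * w - ed) * (ea + c * w - ee) = -(c * w * E2) := by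
    simp only [E2]
    linear_combination -hc2 - c ^ 2 * hcos
  have hy : (ea + c * w - ea) * (ea + c * w - eb) * (ea + c * w - ec) * (ea + c * w - ed)
      * (ea + c * w - ee) = c ^ 3 * w ^ 3 * (E1 * E2) := by
    linear_combination c * w * (ea + c * w - ed) * (ea + c * w - ee) * h1
      - c ^ 2 * w ^ 2 * E1 * h2
  have hx : (ea + c * w) ^ 2 = -(4 * c ^ 2 * w * Complex.sin φ ^ 2) := by
    rw [hea]
    linear_combination 2 * c ^ 2 * w * hsin - c ^ 2 * hcos
  have hE : E1 * E2 ≠ 0 := mul_ne_zero hE1 hE2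
  have hne : c ^ 3 * w ^ 3 * (E1 * E2) ≠ 0 :=
    mul_ne_zero (mul_ne_zero (pow_ne_zero 3 hc) (pow_ne_zero 3 hw)) hE
  rw [hy]
  refine ⟨hne, ?_⟩
  rw [div_eq_div_iff (mul_ne_zero (by norm_num : (4 : ℂ) ≠ 0) hne) hE, mul_pow, hx]
  linear_combination
    -(16 * c ^ 4 * w ^ 3 * Complex.sin φ ^ 2 * (E1 * E2)) * Complex.I_sq
end

section
/- Let e_a < 0 be real, c = −e_a > 0, and let e_b, e_c, e_d, e_e be real numbers with (e_b − e_a)(e_c − e_a) = e_a², (e_d − e_a)(e_e − e_a) = e_a², e_b ≠ e_c and e_d ≠ e_e. For real φ set x = e_a + c·exp(2iφ), y² = (x − e_a)(x − e_b)(x − e_c)(x − e_d)(x − e_e), E₁(φ) = (e_b − e_a) + (e_c − e_a) − 2c·cos(2φ) and E₂(φ) = (e_d − e_a) + (e_e − e_a) − 2c·cos(2φ). Then for every real φ the quantity Q(φ) := (x·2ic·exp(2iφ))²/(4y²) equals 4c·sin²(φ)/(E₁(φ)·E₂(φ)), is real, and: (II-1) if e_b, e_c, e_d, e_e > e_a then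 Q(φ) ≥ 0; (II-2) if e_b, e_c > e_a and e_d, e_e < e_a then Q(φ) ≤ 0; (II-3) if e_b, e_c, e_d, e_e < e_a then Q(φ) ≥ 0. -/
/-- Two positive numbers with product `c ^ 2` have sum at least `2 * c * t` for `t ≤ 1`. -/
theorem two_mul_mul_le_add_of_mul_eq_sq {B C c t : ℝ} (hc : 0 ≤ c) (hB : 0 < B) (hC : 0 < C)
    (h : B * C = c ^ 2) (ht : t ≤ 1) : 2 * c * t ≤ B + C := by
  have h1 : 2 * c ≤ B + C := by
    exact (abs_le_of_sq_le_sq' (by nlinarith [sq_nonneg (B - C)]) (by positivity)).2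
  nlinarith

/-- Two negative numbers with product `c ^ 2` have sum at most `2 * c * t` for `-1 ≤ t`. -/
theorem add_le_two_mul_mul_of_mul_eq_sq {B C c t : ℝ} (hc : 0 ≤ c) (hB : B < 0) (hC : C < 0)
    (h : B * C = c ^ 2) (ht : -1 ≤ t) : B + C ≤ 2 * c * t := by
  have := two_mul_mul_le_add_of_mul_eq_sq hc (neg_pos.2 hB) (neg_pos.2 hC)
    (by linarith [neg_mul_neg B C]) (neg_le.1 ht)
  linarith

/-- A quadratic factor with root product `c ^ 2`, evaluated at `c * w`. -/
theorem mul_sub_mul_mul_sub_eq {c w v B C : ℂ} (hwv : w * v = 1) (h : B * C = c ^ 2) :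
    (c * w - B) * (c * w - C) = -(c * w) * (B + C - c * (w + v)) := by
  linear_combination h - c ^ 2 * hwv

/-- Theorem 3.1 (reality condition for the genus-two loop soliton, branch-free
squared form): with all branch points real, `e_a < 0`, `c = −e_a`, and the two
pair-products `(e_b−e_a)(e_c−e_a) = (e_d−e_a)(e_e−e_a) = e_a²`, the quantity
`Q(φ) = (x·2ic·exp(2iφ))²/(4y²)` equals `4c·sin²φ/(E₁(φ)E₂(φ))`, is real, and
its sign distinguishes the three cases II-1, II-2, II-3. -/
theorem genus_two_reality_condition
    (ea : ℝ) (hea : ea < 0) (c : ℝ) (hc : c = -ea)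
    (eb ec ed ee : ℝ)
    (h1 : (eb - ea) * (ec - ea) = ea ^ 2) (h2 : (ed - ea) * (ee - ea) = ea ^ 2)
    (hbc : eb ≠ ec) (hde : ed ≠ ee) (φ : ℝ) :
    let x : ℂ := (ea : ℂ) + (c : ℂ) * Complex.exp (2 * Complex.I * (φ : ℂ))
    let y2 : ℂ := (x - (ea : ℂ)) * (x - (eb : ℂ)) * (x - (ec : ℂ)) *
      (x - (ed : ℂ)) * (x - (ee : ℂ))
    let E1 : ℝ := (eb - ea) + (ec - ea) - 2 * c * Real.cos (2 * φ)
    let E2 : ℝ := (ed - ea) + (ee - ea) - 2 * c * Real.cos (2 * φ)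
    let Q : ℂ := (x * (2 * Complex.I * (c : ℂ) * Complex.exp (2 * Complex.I * (φ : ℂ)))) ^ 2
      / (4 * y2)
    Q = ((4 * c * Real.sin φ ^ 2 / (E1 * E2) : ℝ) : ℂ) ∧
    (eb > ea → ec > ea → ed > ea → ee > ea → 0 ≤ 4 * c * Real.sin φ ^ 2 / (E1 * E2)) ∧
    (eb > ea → ec > ea → ed < ea → ee < ea → 4 * c * Real.sin φ ^ 2 / (E1 * E2) ≤ 0) ∧
    (eb < ea → ec < ea → ed < ea → ee < ea → 0 ≤ 4 * c * Real.sin φ ^ 2 / (E1 * E2)) := by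
  intro x y2 E1 E2 Q
  have hc0 : 0 < c := by linarith
  have hB : (eb - ea) * (ec - ea) = c ^ 2 := by rw [h1, hc, neg_sq]
  have hD : (ed - ea) * (ee - ea) = c ^ 2 := by rw [h2, hc, neg_sq]
  have hcos : Real.cos (2 * φ) ≤ 1 := Real.cos_le_one _
  have hcos' : -1 ≤ Real.cos (2 * φ) := Real.neg_one_le_cos _
  have hnum : 0 ≤ 4 * c * Real.sin φ ^ 2 := by positivity
  have pos1 : eb > ea → ec > ea → 0 ≤ E1 := fun hb hc' => sub_nonneg.2 <|
    two_mul_mul_le_add_of_mul_eq_sq hc0.le (sub_pos.2 hb) (sub_pos.2 hc') hB hcos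
  have pos2 : ed > ea → ee > ea → 0 ≤ E2 := fun hd he => sub_nonneg.2 <|
    two_mul_mul_le_add_of_mul_eq_sq hc0.le (sub_pos.2 hd) (sub_pos.2 he) hD hcos
  have neg1 : eb < ea → ec < ea → E1 ≤ 0 := fun hb hc' => sub_nonpos.2 <|
    add_le_two_mul_mul_of_mul_eq_sq hc0.le (sub_neg.2 hb) (sub_neg.2 hc') hB hcos'
  have neg2 : ed < ea → ee < ea → E2 ≤ 0 := fun hd he => sub_nonpos.2 <|
    add_le_two_mul_mul_of_mul_eq_sq hc0.le (sub_neg.2 hd) (sub_neg.2 he) hD hcos'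
  refine ⟨?_,
    fun hb hc' hd he => div_nonneg hnum (mul_nonneg (pos1 hb hc') (pos2 hd he)),
    fun hb hc' hd he =>
      div_nonpos_of_nonneg_of_nonpos hnum
        (mul_nonpos_of_nonneg_of_nonpos (pos1 hb hc') (neg2 hd he)),
    fun hb hc' hd he =>
      div_nonneg hnum (mul_nonneg_of_nonpos_of_nonpos (neg1 hb hc') (neg2 hd he))⟩
  set w : ℂ := Complex.exp (2 * Complex.I * (φ : ℂ)) with hw
  set v : ℂ := Complex.exp (-(2 * Complex.I * (φ : ℂ))) with hv
  have hwv : w * v = 1 := by rw [hw, hv, ← Complex.exp_add, add_neg_cancel, Complex.exp_zero]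
  have hw0 : w ≠ 0 := Complex.exp_ne_zero _
  have hcC : (c : ℂ) ≠ 0 := Complex.ofReal_ne_zero.2 hc0.ne'
  have hcosC : 2 * ((Real.cos (2 * φ) : ℝ) : ℂ) = w + v := by
    rw [Complex.ofReal_cos, Complex.two_cos, hw, hv]
    push_cast
    congr 2 <;> ring
  have hsinC : 4 * ((Real.sin φ ^ 2 : ℝ) : ℂ) = 2 - (w + v) := by
    rw [Real.sin_sq_eq_half_sub, ← hcosC]
    push_cast
    ring
  have hE1 : (E1 : ℂ) = (eb - ea) + (ec - ea) - c * (w + v) := by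
    rw [← hcosC]
    simp only [E1]
    push_cast
    ring
  have hE2 : (E2 : ℂ) = (ed - ea) + (ee - ea) - c * (w + v) := by
    rw [← hcosC]
    simp only [E2]
    push_cast
    ring
  have hBC := mul_sub_mul_mul_sub_eq (c := c) (B := eb - ea) (C := ec - ea) hwv
    (by exact_mod_cast hB)
  have hDE := mul_sub_mul_mul_sub_eq (c := c) (B := ed - ea) (C := ee - ea) hwv
    (by exact_mod_cast hD)
  rw [← hE1] at hBC
  rw [← hE2] at hDE
  have hy : y2 = (c * w) ^ 3 * (E1 * E2) := by
    calc y2 = c * w * ((c * w - (eb - ea)) * (c * w - (ec - ea))) *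
          ((c * w - (ed - ea)) * (c * w - (ee - ea))) := by simp only [y2, x]; ring
      _ = (c * w) ^ 3 * (E1 * E2) := by rw [hBC, hDE]; ring
  have hx : x = c * (w - 1) := by
    simp only [x]
    rw [show ea = -c by linarith]
    push_cast
    ring
  have hnumC : (x * (2 * Complex.I * c * w)) ^ 2 =
      4 * (c * w) ^ 3 * (4 * c * ((Real.sin φ ^ 2 : ℝ) : ℂ)) := by
    rw [hx]
    linear_combination (4 * c ^ 4 * w ^ 2 * (w - 1) ^ 2 : ℂ) * Complex.I_sq
      - 4 * (c : ℂ) ^ 4 * w ^ 3 * hsinC + 4 * (c : ℂ) ^ 4 * w ^ 2 * hwv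
  have hk : (4 * (c * w) ^ 3 : ℂ) ≠ 0 :=
    mul_ne_zero (by norm_num) (pow_ne_zero _ (mul_ne_zero hcC hw0))
  simp only [Q]
  rw [hnumC, hy, ← mul_assoc 4, mul_div_mul_left _ _ hk]
  push_cast
  rfl
end

section
/- Let g ≥ 1, let e_a < 0 be real, c = −e_a > 0, and let (e_{b_j}, e_{c_j}) for j = 1, …, g be real numbers with (e_{b_j} − e_a)(e_{c_j} − e_a) = e_a² and e_{b_j} ≠ e_{c_j} for every j. For real φ set x = e_a + c·exp(2iφ), y² = (x − e_a)·∏_{j=1}^{g}(x − e_{b_j})(x − e_{c_j}), and E_j(φ) = (e_{b_j} − e_a) + (e_{c_j} − e_a) − 2c·cos(2φ). Then: (i) for each j, either both e_{b_j}, e_{c_j} > e_a or both < e_a; (ii) E_j(φ) > 0 for all real φ if the pair lies above e_a, and E_j(φ) < 0 for all real φ if the pair lies below e_a; (iii) the quantity Q(φ) := (x^{g−1}·2ic·exp(2iφ))²/(4y²) is real for every real φ, equal to (4c·sin²φ)^{g−1}/∏_{j=1}^{g}E_j(φ), and its sign is (−1)^m (or zero when g ≥ 2 and sin φ = 0), where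 m is the number of pairs lying below e_a. -/
open scoped BigOperators

theorem two_mul_lt_add_of_mul_eq_sq {a b c : ℝ} (ha : 0 < a) (hb : 0 < b)
    (hab : a * b = c ^ 2) (hne : a ≠ b) : 2 * c < a + b := by
  have h : 0 < (a - b) ^ 2 := by
    have := sub_ne_zero.mpr hne
    positivity
  exact lt_of_pow_lt_pow_left₀ 2 (by positivity) (by nlinarith)

theorem add_sub_mul_cos_pos {a b c : ℝ} (hc : 0 < c) (ha : 0 < a) (hb : 0 < b)
    (hab : a * b = c ^ 2) (hne : a ≠ b) (θ : ℝ) : 0 < a + b - 2 * c * Real.cos θ := by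
  nlinarith [two_mul_lt_add_of_mul_eq_sq ha hb hab hne, Real.cos_le_one θ]

theorem add_sub_mul_cos_neg {a b c : ℝ} (hc : 0 < c) (ha : a < 0) (hb : b < 0)
    (hab : a * b = c ^ 2) (hne : a ≠ b) (θ : ℝ) : a + b - 2 * c * Real.cos θ < 0 := by
  have h := two_mul_lt_add_of_mul_eq_sq (c := c) (neg_pos.mpr ha) (neg_pos.mpr hb)
    (by linarith [neg_mul_neg a b]) (neg_injective.ne hne)
  nlinarith [Real.neg_one_le_cos θ]

theorem exp_two_I_mul_sub_one_sq (φ : ℝ) :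
    (Complex.exp (2 * Complex.I * φ) - 1) ^ 2 =
      -4 * Complex.exp (2 * Complex.I * φ) * (Real.sin φ : ℂ) ^ 2 := by
  have h1 : Complex.exp (2 * Complex.I * φ) = Complex.exp (φ * Complex.I) ^ 2 := by
    rw [← Complex.exp_nat_mul]; congr 1; push_cast; ring
  rw [h1, Complex.exp_mul_I, Complex.ofReal_sin]
  have hs := Complex.sin_sq_add_cos_sq (φ : ℂ)
  have hw : (Complex.cos φ + Complex.sin φ * Complex.I) ^ 2 - 1 =
      2 * Complex.I * Complex.sin φ * (Complex.cos φ + Complex.sin φ * Complex.I) := by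
    linear_combination hs - Complex.sin (φ : ℂ) ^ 2 * Complex.I_sq
  rw [hw]
  linear_combination 4 * Complex.sin (φ : ℂ) ^ 2 *
    (Complex.cos φ + Complex.sin φ * Complex.I) ^ 2 * Complex.I_sq

theorem exp_two_I_mul_sq_add_one (φ : ℝ) :
    Complex.exp (2 * Complex.I * φ) ^ 2 + 1 =
      2 * (Real.cos (2 * φ) : ℂ) * Complex.exp (2 * Complex.I * φ) := by
  have h1 : Complex.exp (2 * Complex.I * φ) = Complex.exp (((2 * φ : ℝ) : ℂ) * Complex.I) := by
    congr 1; push_cast; ring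
  rw [h1, Complex.exp_mul_I, Complex.ofReal_cos]
  have hs := Complex.sin_sq_add_cos_sq ((2 * φ : ℝ) : ℂ)
  linear_combination Complex.sin ((2 * φ : ℝ) : ℂ) ^ 2 * Complex.I_sq - hs

theorem neg_one_pow_card_filter_mul_prod_pos {ι : Type*} [Fintype ι] (p : ι → Prop)
    [DecidablePred p] (f : ι → ℝ) (hpos : ∀ i, ¬ p i → 0 < f i) (hneg : ∀ i, p i → f i < 0) :
    0 < (-1 : ℝ) ^ (Finset.univ.filter p).card * ∏ i, f i := by
  rw [← Finset.prod_const, Finset.prod_filter, ← Finset.prod_mul_distrib]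
  refine Finset.prod_pos fun i _ => ?_
  split_ifs with h
  · linarith [hneg i h]
  · linarith [hpos i h]

/-- Theorem 1.3 / Theorem 4.1 (reality condition for the loop soliton of
genus `g`, branch-free squared form): for real branch points with `e_a < 0`,
`c = −e_a`, and `g` pairs `(e_{b_j}, e_{c_j})` satisfying
`(e_{b_j}−e_a)(e_{c_j}−e_a) = e_a²`, `e_{b_j} ≠ e_{c_j}`:
(i) each pair lies entirely above or entirely below `e_a`;
(ii) `E_j(φ) > 0` for pairs above and `E_j(φ) < 0` for pairs below;
(iii) `Q(φ) = (x^{g−1}·2ic·exp(2iφ))²/(4y²)` is real, equal to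
`(4c·sin²φ)^{g−1}/∏_j E_j(φ)`, with sign `(−1)^m` (`m` = number of pairs
below `e_a`), or zero when `g ≥ 2` and `sin φ = 0`. -/
theorem genus_g_reality_condition
    (g : ℕ) (hg : 1 ≤ g) (ea : ℝ) (hea : ea < 0) (c : ℝ) (hc : c = -ea)
    (eb ec : Fin g → ℝ)
    (hpair : ∀ j, (eb j - ea) * (ec j - ea) = ea ^ 2)
    (hne : ∀ j, eb j ≠ ec j) (φ : ℝ) :
    let x : ℂ := (ea : ℂ) + (c : ℂ) * Complex.exp (2 * Complex.I * (φ : ℂ))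
    let y2 : ℂ := (x - (ea : ℂ)) * ∏ j : Fin g, (x - (eb j : ℂ)) * (x - (ec j : ℂ))
    let E : Fin g → ℝ := fun j =>
      (eb j - ea) + (ec j - ea) - 2 * c * Real.cos (2 * φ)
    let R : ℝ := (4 * c * Real.sin φ ^ 2) ^ (g - 1) / ∏ j : Fin g, E j
    let m : ℕ := (Finset.univ.filter (fun j : Fin g => eb j < ea)).card
    (∀ j, (ea < eb j ∧ ea < ec j) ∨ (eb j < ea ∧ ec j < ea)) ∧
    (∀ j, (ea < eb j ∧ ea < ec j → 0 < E j) ∧ (eb j < ea ∧ ec j < ea → E j < 0)) ∧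
    (x ^ (g - 1) * (2 * Complex.I * (c : ℂ) * Complex.exp (2 * Complex.I * (φ : ℂ)))) ^ 2
        / (4 * y2) = ((R : ℝ) : ℂ) ∧
    (2 ≤ g → Real.sin φ = 0 → R = 0) ∧
    (Real.sin φ ≠ 0 ∨ g = 1 → 0 < (-1 : ℝ) ^ m * R) := by
  intro x y2 E R m
  have hc0 : 0 < c := by linarith
  have hpair' : ∀ j, (eb j - ea) * (ec j - ea) = c ^ 2 := fun j => by
    rw [hpair j, hc, neg_sq]
  have hne' : ∀ j, eb j - ea ≠ ec j - ea := fun j h => hne j (sub_left_injective h)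
  have hside : ∀ j, (ea < eb j ∧ ea < ec j) ∨ (eb j < ea ∧ ec j < ea) := fun j => by
    have h : 0 < (eb j - ea) * (ec j - ea) := by rw [hpair' j]; positivity
    simpa only [sub_pos, sub_neg] using mul_pos_iff.mp h
  have hEpos : ∀ j, ea < eb j ∧ ea < ec j → 0 < E j := fun j h =>
    add_sub_mul_cos_pos hc0 (sub_pos.mpr h.1) (sub_pos.mpr h.2) (hpair' j) (hne' j) _
  have hEneg : ∀ j, eb j < ea ∧ ec j < ea → E j < 0 := fun j h =>
    add_sub_mul_cos_neg hc0 (sub_neg.mpr h.1) (sub_neg.mpr h.2) (hpair' j) (hne' j) _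
  have hP : 0 < (-1 : ℝ) ^ m * ∏ j, E j :=
    neg_one_pow_card_filter_mul_prod_pos _ E
      (fun j h => hEpos j ((hside j).resolve_right fun h' => h h'.1))
      (fun j h => hEneg j ((hside j).resolve_left fun h' => lt_asymm h h'.1))
  have hP0 : ∏ j, E j ≠ 0 := right_ne_zero_of_mul hP.ne'
  refine ⟨hside, fun j => ⟨hEpos j, hEneg j⟩, ?_, ?_, ?_⟩
  · obtain ⟨n, rfl⟩ : ∃ n, g = n + 1 := ⟨g - 1, by omega⟩
    set u := Complex.exp (2 * Complex.I * (φ : ℂ)) with hu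
    have hu0 : u ≠ 0 := Complex.exp_ne_zero _
    have hcC : (c : ℂ) ≠ 0 := Complex.ofReal_ne_zero.mpr hc0.ne'
    have heac : (ea : ℂ) = -c := by rw [hc]; push_cast; ring
    have hx2 : x ^ 2 = (4 * c * (Real.sin φ : ℂ) ^ 2) * (-(c * u)) := by
      have h := exp_two_I_mul_sub_one_sq φ
      rw [← hu] at h
      simp only [x, heac]
      linear_combination (c : ℂ) ^ 2 * h
    have hfactor : ∀ j, (x - (eb j : ℂ)) * (x - (ec j : ℂ)) = -(c * u) * (E j : ℂ) := fun j => by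
      have h := exp_two_I_mul_sq_add_one φ
      have hp : ((eb j : ℂ) - ea) * (ec j - ea) = c ^ 2 := by exact_mod_cast hpair' j
      rw [← hu] at h
      simp only [x, E]
      push_cast at h ⊢
      linear_combination (c : ℂ) ^ 2 * h + hp
    have hy2 : y2 = c * u * ((-(c * u)) ^ (n + 1) * ∏ j, (E j : ℂ)) := by
      simp only [y2, hfactor, Finset.prod_mul_distrib, Finset.prod_const, Finset.card_univ,
        Fintype.card_fin]
      simp only [x, add_sub_cancel_left, ← hu]
    have h4 : (4 : ℂ) ≠ 0 := by norm_num
    have hPC : ∏ j, (E j : ℂ) ≠ 0 := by exact_mod_cast hP0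
    have hv : (-(c * u)) ^ (n + 1) ≠ 0 := pow_ne_zero _ (neg_ne_zero.mpr (mul_ne_zero hcC hu0))
    have hR : (R : ℂ) = (4 * c * (Real.sin φ : ℂ) ^ 2) ^ n / ∏ j, (E j : ℂ) := by
      simp only [R, add_tsub_cancel_right]
      push_cast
      rfl
    rw [hR, hy2, mul_pow, add_tsub_cancel_right, pow_right_comm, hx2, mul_pow, div_eq_div_iff
      (mul_ne_zero h4 (mul_ne_zero (mul_ne_zero hcC hu0) (mul_ne_zero hv hPC))) hPC]
    linear_combination 4 * (4 * c * (Real.sin φ : ℂ) ^ 2) ^ n * (-(c * u)) ^ n *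
      (c * u) ^ 2 * (∏ j, (E j : ℂ)) * Complex.I_sq
  · intro hg2 hs
    have : g - 1 ≠ 0 := by omega
    simp [R, hs, this]
  · intro h
    have hN : 0 < (4 * c * Real.sin φ ^ 2) ^ (g - 1) := by
      rcases h with h | rfl
      · positivity
      · simp
    have hR : (-1 : ℝ) ^ m * R =
        (4 * c * Real.sin φ ^ 2) ^ (g - 1) * ((-1 : ℝ) ^ m * ∏ j, E j) / (∏ j, E j) ^ 2 := by
      simp only [R]
      field_simp
    rw [hR]
    positivity
end
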